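/- Let $h:\mathcal S\times\mathcal X\to\mathbb Z_q^m$ be a $k^*$-universal hash function ($k \ge 2$), $X$ a random variable on $\mathcal X$, $S$ uniform on $\mathcal S$ independent of $X$, and $U$ uniform on $\mathbb Z_q^m$. If $m \le H_k(X) - \log_q\big(\frac{k}{2\epsilon\ln q}\big)$ for some $\epsilon > 0$, then the conditional Rényi divergence of order infinity satisfies $D_\infty(P_{h(S,X)}\|P_U\mid P_S) \le \frac{m}{k} + \epsilon$. -/

import Mathlib

open Finset

/-- Rényi entropy of order `α > 1` (base-`q` logarithm). -/
noncomputable def renyiH {X : Type*} [Fintype X] (q : ℕ) (α : ℝ) (P : X → ℝ) : ℝ :=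
  (1 - α)⁻¹ * Real.logb q (∑ x, P x ^ α)

/-- Lyapunov's inequality for the moments of a finite probability vector. -/
theorem sum_pow_succ_le_rpow_pow {X : Type*} [Fintype X] {P : X → ℝ}
    (hP0 : ∀ x, 0 ≤ P x) (hP1 : ∑ x, P x = 1) {c d : ℕ} (hcd : c ≤ d) :
    ∑ x, P x ^ (c + 1) ≤ ((∑ x, P x ^ (d + 1)) ^ (d : ℝ)⁻¹) ^ c := by
  rcases Nat.eq_zero_or_pos c with rfl | hc
  · simp [hP1]
  have hc' : (0 : ℝ) < c := by exact_mod_cast hc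
  have hd' : (0 : ℝ) < d := by exact_mod_cast hc.trans_le hcd
  have hp : (1 : ℝ) ≤ d / c := by
    rw [le_div_iff₀ hc', one_mul]
    exact_mod_cast hcd
  have hA : 0 ≤ ∑ x, P x ^ (c + 1) := sum_nonneg fun x _ => pow_nonneg (hP0 x) _
  have hB : 0 ≤ ∑ x, P x ^ (d + 1) := sum_nonneg fun x _ => pow_nonneg (hP0 x) _
  have jensen := Real.rpow_arith_mean_le_arith_mean_rpow univ P (fun x => P x ^ c)
    (fun x _ => hP0 x) hP1 (fun x _ => pow_nonneg (hP0 x) _) hp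
  have hpow : ∀ x, P x * (P x ^ c) ^ ((d : ℝ) / c) = P x ^ (d + 1) := fun x => by
    rw [← Real.rpow_natCast (P x) c, ← Real.rpow_mul (hP0 x), mul_div_cancel₀ _ hc'.ne',
      Real.rpow_natCast, pow_succ']
  simp only [hpow, ← pow_succ'] at jensen
  calc ∑ x, P x ^ (c + 1)
      = ((∑ x, P x ^ (c + 1)) ^ ((d : ℝ) / c)) ^ ((c : ℝ) / d) := by
        rw [← Real.rpow_mul hA, div_mul_div_cancel₀ hc'.ne', div_self hd'.ne', Real.rpow_one]
    _ ≤ (∑ x, P x ^ (d + 1)) ^ ((c : ℝ) / d) := by gcongr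
    _ = ((∑ x, P x ^ (d + 1)) ^ (d : ℝ)⁻¹) ^ c := by
        rw [← Real.rpow_natCast _ c, ← Real.rpow_mul hB, inv_mul_eq_div]

/-- Prepending an entry multiplies the repetition weight by at most one plus `N` times the number
of earlier occurrences of that entry. -/
theorem pow_sub_card_image_cons_le {X : Type*} [DecidableEq X] {N : ℝ} (hN : 0 ≤ N) {n : ℕ}
    (a : X) (x : Fin n → X) :
    N ^ (n + 1 - (univ.image (Fin.cons a x : Fin (n + 1) → X)).card) ≤
      N ^ (n - (univ.image x).card) * (1 + N * ∑ i, if x i = a then 1 else 0) := by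
  have him : univ.image (Fin.cons a x : Fin (n + 1) → X) = insert a (univ.image x) := by
    ext y
    simp [Fin.exists_fin_succ, eq_comm]
  have hcard : (univ.image x).card ≤ n := by
    simpa using card_image_le (s := univ) (f := x)
  have hsum : (0 : ℝ) ≤ ∑ i, if x i = a then 1 else 0 :=
    sum_nonneg fun i _ => by split_ifs <;> norm_num
  have hw : 0 ≤ N ^ (n - (univ.image x).card) := pow_nonneg hN _
  rw [him]
  by_cases ha : a ∈ univ.image x
  · obtain ⟨i, -, hi⟩ := mem_image.1 ha
    have hone : (1 : ℝ) ≤ ∑ i, if x i = a then 1 else 0 := by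
      have := single_le_sum (f := fun i => if x i = a then (1 : ℝ) else 0)
        (fun j _ => by split_ifs <;> norm_num) (mem_univ i)
      simpa [hi] using this
    rw [insert_eq_of_mem ha, Nat.sub_add_comm hcard, pow_succ]
    gcongr
    nlinarith
  · rw [card_insert_of_notMem ha, Nat.add_sub_add_right]
    exact le_mul_of_one_le_right hw (le_add_of_nonneg_right (mul_nonneg hN hsum))

/-- Sums over tuples, weighted by `N` to the number of repeated entries, are controlled by the
moments of `P`. -/
theorem sum_pow_sub_card_image_mul_prod_le {X : Type*} [Fintype X] [DecidableEq X] {P : X → ℝ}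
    (hP0 : ∀ x, 0 ≤ P x) {N r : ℝ} (hN : 0 ≤ N) (hr : 0 ≤ r) {k : ℕ}
    (hmom : ∀ c < k, ∑ x, P x ^ (c + 1) ≤ r ^ c) (n : ℕ) (c : Fin n → ℕ)
    (hc : ∑ i, c i + n ≤ k) :
    ∑ x : Fin n → X, N ^ (n - (univ.image x).card) * ∏ i, P (x i) ^ (c i + 1) ≤
      r ^ (∑ i, c i) * ∏ j ∈ range n, (1 + j * (N * r)) := by
  induction n with
  | zero => simp
  | succ n ih =>
    set W : (Fin n → X) → ℝ := fun x => N ^ (n - (univ.image x).card) with hW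
    have hW0 : ∀ x, 0 ≤ W x := fun x => pow_nonneg hN _
    set Q : (Fin n → X) → ℝ := fun x => ∏ i, P (x i) ^ (c i.succ + 1) with hQ
    have hQ0 : ∀ x, 0 ≤ Q x := fun x => prod_nonneg fun i _ => pow_nonneg (hP0 _) _
    have hsumc : ∑ i, c i = c 0 + ∑ i : Fin n, c i.succ := Fin.sum_univ_succ c
    set T : ℕ := ∑ i : Fin n, c i.succ with hT
    set B : ℝ := ∏ j ∈ range n, (1 + j * (N * r)) with hB
    have hnew : ∑ x, W x * Q x ≤ r ^ T * B := ih (fun i => c i.succ) (by omega)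
    have hold : ∀ i : Fin n, ∑ x, W x * Q x * P (x i) ^ (c 0 + 1) ≤ r ^ (T + (c 0 + 1)) * B := by
      intro i
      have hs : ∑ j, (c j.succ + if j = i then c 0 + 1 else 0) = T + (c 0 + 1) := by
        simp [sum_add_distrib, hT]
      have := ih (fun j => c j.succ + if j = i then c 0 + 1 else 0) (by rw [hs]; omega)
      rw [hs] at this
      refine le_trans (le_of_eq (sum_congr rfl fun x _ => ?_)) this
      rw [mul_assoc]
      congr 1
      have : ∀ j, P (x j) ^ (c j.succ + (if j = i then c 0 + 1 else 0) + 1) =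
          P (x j) ^ (c j.succ + 1) * (if j = i then P (x j) ^ (c 0 + 1) else 1) := by
        intro j
        split_ifs
        · rw [← pow_add]; congr 1; ring
        · simp
      simp only [this, prod_mul_distrib, prod_ite_eq', mem_univ, if_true, hQ]
    calc ∑ x : Fin (n + 1) → X,
          N ^ (n + 1 - (univ.image x).card) * ∏ i, P (x i) ^ (c i + 1)
        = ∑ a : X, ∑ x : Fin n → X,
            N ^ (n + 1 - (univ.image (Fin.cons a x : Fin (n + 1) → X)).card) *
              (P a ^ (c 0 + 1) * Q x) := by
          rw [← Fintype.sum_prod_type', ← (Fin.consEquiv fun _ : Fin (n + 1) => X).sum_comp]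
          refine sum_congr rfl fun y _ => ?_
          simp [Fin.consEquiv, Fin.prod_univ_succ, hQ]
      _ ≤ ∑ a : X, ∑ x : Fin n → X,
            (W x * (1 + N * ∑ i, if x i = a then 1 else 0)) * (P a ^ (c 0 + 1) * Q x) := by
          refine sum_le_sum fun a _ => sum_le_sum fun x _ => ?_
          exact mul_le_mul_of_nonneg_right (pow_sub_card_image_cons_le hN a x)
            (mul_nonneg (pow_nonneg (hP0 a) _) (hQ0 x))
      _ = (∑ a, P a ^ (c 0 + 1)) * (∑ x, W x * Q x) +
            N * ∑ i : Fin n, ∑ x, W x * Q x * P (x i) ^ (c 0 + 1) := by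
          have hpt : ∀ x : Fin n → X,
              ∑ a : X, (W x * (1 + N * ∑ i, if x i = a then 1 else 0)) *
                (P a ^ (c 0 + 1) * Q x) =
              (∑ a, P a ^ (c 0 + 1)) * (W x * Q x) +
                N * ∑ i, W x * Q x * P (x i) ^ (c 0 + 1) := by
            intro x
            have hswap : ∑ i, P (x i) ^ (c 0 + 1) =
                ∑ a, (∑ i, if x i = a then 1 else 0) * P a ^ (c 0 + 1) := by
              simp only [sum_mul]
              rw [sum_comm]
              simp
            rw [← mul_sum, hswap, mul_sum, mul_sum, sum_mul, ← sum_add_distrib]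
            refine sum_congr rfl fun a _ => ?_
            ring
          rw [sum_comm, sum_congr rfl fun x _ => hpt x, sum_add_distrib, ← mul_sum, ← mul_sum,
            sum_comm]
      _ ≤ r ^ c 0 * (r ^ T * B) + N * ∑ _i : Fin n, r ^ (T + (c 0 + 1)) * B := by
          gcongr with i
          · exact sum_nonneg fun x _ => mul_nonneg (hW0 x) (hQ0 x)
          · exact hmom _ (by omega)
          · exact hold i
      _ = r ^ (∑ i, c i) * ∏ j ∈ range (n + 1), (1 + j * (N * r)) := by
          rw [prod_range_succ, hsumc, ← hB]
          simp only [sum_const, card_univ, Fintype.card_fin, nsmul_eq_mul]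
          ring

/-- A product of the factors `1 + j t` is at most the exponential of their sum. -/
theorem prod_one_add_mul_le_exp {t : ℝ} (ht : 0 ≤ t) (n : ℕ) :
    ∏ j ∈ range n, (1 + j * t) ≤ Real.exp (n * (n - 1) / 2 * t) := by
  induction n with
  | zero => simp
  | succ n ih =>
    rw [prod_range_succ]
    have : ((n + 1 : ℕ) : ℝ) * ((n + 1 : ℕ) - 1) / 2 * t = n * (n - 1) / 2 * t + n * t := by
      push_cast
      ring
    rw [this, Real.exp_add]
    have h1 : 1 + (n : ℝ) * t ≤ Real.exp (n * t) := by
      linarith [Real.add_one_le_exp ((n : ℝ) * t)]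
    gcongr

/-- The sum of the `k`-th powers of the masses of the fibres of `f` is a sum over the `k`-tuples
on which `f` is constant. -/
theorem sum_fiber_pow {X U : Type*} [Fintype X] [Fintype U] [DecidableEq U]
    (f : X → U) (P : X → ℝ) {k : ℕ} (hk : 0 < k) :
    ∑ u, (∑ x, if f x = u then P x else 0) ^ k =
      ∑ x : Fin k → X, if ∀ i j, f (x i) = f (x j) then ∏ i, P (x i) else 0 := by
  simp only [Fintype.sum_pow]
  rw [sum_comm]
  refine sum_congr rfl fun x _ => ?_
  have hprod : ∀ u, (∏ i, if f (x i) = u then P (x i) else 0) =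
      if ∀ i, f (x i) = u then ∏ i, P (x i) else 0 := by
    intro u
    rw [prod_ite_zero]
    simp
  simp only [hprod]
  split_ifs with hx
  · rw [sum_eq_single (f (x ⟨0, hk⟩))]
    · rw [if_pos fun i => hx i _]
    · intro u _ hu
      exact if_neg fun hall => hu (hall _).symm
    · simp
  · exact sum_eq_zero fun u _ => if_neg fun hall => hx fun i j => (hall i).trans (hall j).symm

/-- Universality bounds the collision probability of an arbitrary tuple in terms of the number
of its distinct entries. -/
theorem collision_le_of_universal {S X U : Type*} [Fintype S] [Nonempty S] [DecidableEq X]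
    [DecidableEq U] (q m k : ℕ) (h : S → X → U)
    (hUniv : ∀ l : ℕ, 2 ≤ l → l ≤ k → ∀ x : Fin l → X, Function.Injective x →
      ((univ.filter fun s : S => ∀ i j, h s (x i) = h s (x j)).card : ℝ)
          / (Fintype.card S : ℝ)
        ≤ ((q : ℝ) ^ (m * (l - 1)))⁻¹) (x : Fin k → X) :
    ((univ.filter fun s : S => ∀ i j, h s (x i) = h s (x j)).card : ℝ) / (Fintype.card S : ℝ)
      ≤ ((q : ℝ) ^ (m * ((univ.image x).card - 1)))⁻¹ := by
  rcases Nat.lt_or_ge (univ.image x).card 2 with hl | hl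
  · have : (univ.image x).card - 1 = 0 := by omega
    rw [this, mul_zero, pow_zero, inv_one]
    refine div_le_one_of_le₀ ?_ (Nat.cast_nonneg _)
    exact_mod_cast card_le_univ _
  · have hle : (univ.image x).card ≤ k := by simpa using card_image_le (s := univ) (f := x)
    set e := (univ.image x).equivFin.symm with he
    refine le_trans ?_ (hUniv _ hl hle (fun i => (e i : X))
      (Subtype.val_injective.comp e.injective))
    gcongr with s
    intro hs i j
    obtain ⟨i', -, hi⟩ := mem_image.1 (e i).2
    obtain ⟨j', -, hj⟩ := mem_image.1 (e j).2
    rw [← hi, ← hj]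
    exact hs i' j'

/-- The averaged, normalized `k`-th power sum of the hash output of a universal family. -/
theorem universal_power_sum_le {S X : Type*} [Fintype S] [Fintype X] [Nonempty S]
    (q m k : ℕ) (hq : 0 < q) (hk : 0 < k) (h : S → X → (Fin m → Fin q)) {P : X → ℝ}
    (hP0 : ∀ x, 0 ≤ P x)
    (hUniv : ∀ l : ℕ, 2 ≤ l → l ≤ k → ∀ x : Fin l → X, Function.Injective x →
      ((univ.filter fun s : S => ∀ i j, h s (x i) = h s (x j)).card : ℝ)
          / (Fintype.card S : ℝ)
        ≤ ((q : ℝ) ^ (m * (l - 1)))⁻¹)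
    {r : ℝ} (hr : 0 ≤ r) (hmom : ∀ c < k, ∑ x, P x ^ (c + 1) ≤ r ^ c) :
    ∑ s : S, (Fintype.card S : ℝ)⁻¹ *
        ∑ u : Fin m → Fin q, ((q : ℝ) ^ m * ∑ x : X, if h s x = u then P x else 0) ^ k
      ≤ (q : ℝ) ^ m * Real.exp (k * (k - 1) / 2 * ((q : ℝ) ^ m * r)) := by
  classical
  set N : ℝ := (q : ℝ) ^ m with hNdef
  have hq' : (0 : ℝ) < q := by exact_mod_cast hq
  have hN : 0 < N := pow_pos hq' m
  have hcoll : ∀ x : Fin k → X,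
      N ^ k * (((univ.filter fun s : S => ∀ i j, h s (x i) = h s (x j)).card : ℝ)
        / (Fintype.card S : ℝ)) ≤ N * N ^ (k - (univ.image x).card) := by
    intro x
    have hle : (univ.image x).card ≤ k := by simpa using card_image_le (s := univ) (f := x)
    have hpos : 0 < (univ.image x).card :=
      card_pos.2 ⟨x ⟨0, hk⟩, mem_image_of_mem x (mem_univ _)⟩
    have := collision_le_of_universal q m k h hUniv x
    rw [pow_mul, ← hNdef] at this
    refine (mul_le_mul_of_nonneg_left this (pow_nonneg hN.le k)).trans (le_of_eq ?_)
    rw [mul_inv_eq_iff_eq_mul₀ (pow_pos hN _).ne', ← pow_succ', ← pow_add]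
    congr 1
    omega
  calc ∑ s : S, (Fintype.card S : ℝ)⁻¹ *
        ∑ u : Fin m → Fin q, (N * ∑ x : X, if h s x = u then P x else 0) ^ k
      = ∑ x : Fin k → X, (N ^ k *
          (((univ.filter fun s : S => ∀ i j, h s (x i) = h s (x j)).card : ℝ)
            / (Fintype.card S : ℝ))) * ∏ i, P (x i) := by
        simp only [mul_pow, ← mul_sum, sum_fiber_pow _ P hk]
        rw [sum_comm, mul_sum, mul_sum]
        refine sum_congr rfl fun x _ => ?_
        rw [← sum_filter, sum_const, nsmul_eq_mul]
        ring
    _ ≤ ∑ x : Fin k → X, (N * N ^ (k - (univ.image x).card)) * ∏ i, P (x i) := by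
        exact sum_le_sum fun x _ =>
          mul_le_mul_of_nonneg_right (hcoll x) (prod_nonneg fun i _ => hP0 _)
    _ = N * ∑ x : Fin k → X, N ^ (k - (univ.image x).card) * ∏ i, P (x i) ^ (0 + 1) := by
        simp only [mul_sum, zero_add, pow_one, mul_assoc]
    _ ≤ N * ∏ j ∈ range k, (1 + j * (N * r)) := by
        have := sum_pow_sub_card_image_mul_prod_le hP0 hN.le hr hmom k (fun _ => 0) (by simp)
        simp only [sum_const_zero, pow_zero, one_mul] at this
        gcongr
    _ ≤ N * Real.exp (k * (k - 1) / 2 * (N * r)) := by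
        gcongr
        exact prod_one_add_mul_le_exp (mul_nonneg hN.le hr) k

/-- For a probability vector `p`, the largest normalized log-likelihood is bounded by the tangent
line at `c` of the logarithm of the normalized `k`-th power sum. -/
theorem iSup_logb_le_tangent {U : Type*} [Fintype U] [Nonempty U] {p : U → ℝ}
    (hp0 : ∀ u, 0 ≤ p u) (hp1 : ∑ u, p u = 1) {b c : ℝ} (hb : 1 < b) (hc : 0 < c)
    {k : ℕ} (hk : 0 < k) :
    (⨆ u, Real.logb b (Fintype.card U * p u)) ≤
      (Real.log c + (∑ u, (Fintype.card U * p u) ^ k) / c - 1) / (k * Real.log b) := by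
  have hlogb : 0 < Real.log b := Real.log_pos hb
  have hk' : (0 : ℝ) < k := by exact_mod_cast hk
  have hy0 : ∀ u, 0 ≤ Fintype.card U * p u := fun u => mul_nonneg (Nat.cast_nonneg _) (hp0 u)
  have hpos : ∀ u, 0 < Fintype.card U * p u → Real.logb b (Fintype.card U * p u) ≤
      (Real.log c + (∑ u, (Fintype.card U * p u) ^ k) / c - 1) / (k * Real.log b) := by
    intro u hu
    have hlog := Real.log_le_sub_one_of_pos (div_pos (pow_pos hu k) hc)
    rw [Real.log_div (pow_pos hu k).ne' hc.ne', Real.log_pow] at hlog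
    have hsum : (Fintype.card U * p u) ^ k ≤ ∑ u, (Fintype.card U * p u) ^ k :=
      single_le_sum (f := fun u => (Fintype.card U * p u) ^ k)
        (fun v _ => pow_nonneg (hy0 v) k) (mem_univ u)
    have hdiv := div_le_div_of_nonneg_right hsum hc.le
    rw [Real.logb, div_le_div_iff₀ hlogb (mul_pos hk' hlogb)]
    nlinarith
  obtain ⟨u₀, -, hu₀⟩ : ∃ u ∈ (univ : Finset U), 1 ≤ Fintype.card U * p u := by
    refine exists_le_of_sum_le univ_nonempty ?_
    rw [← mul_sum, hp1]
    simp
  refine ciSup_le fun u => ?_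
  rcases (hy0 u).eq_or_lt with hu | hu
  · rw [← hu, Real.logb_zero]
    exact (Real.logb_nonneg hb hu₀).trans (hpos u₀ (zero_lt_one.trans_le hu₀))
  · exact hpos u hu

/-- The entropy gap hypothesis in multiplicative form. -/
theorem pow_mul_rpow_le_of_le_renyiH {X : Type*} [Fintype X] {P : X → ℝ} {q m d : ℕ}
    (hq : 2 ≤ q) {ε : ℝ} (hε : 0 < ε) (hpos : 0 < ∑ x, P x ^ (d + 1))
    (hmH : (m : ℝ) ≤ renyiH q ((d + 1 : ℕ) : ℝ) P -
      Real.logb q (((d + 1 : ℕ) : ℝ) / (2 * ε * Real.log q))) :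
    (q : ℝ) ^ m * (∑ x, P x ^ (d + 1)) ^ (d : ℝ)⁻¹ ≤ 2 * ε * Real.log q / (d + 1 : ℕ) := by
  have hq1 : (1 : ℝ) < q := by exact_mod_cast hq
  have hq0 : (0 : ℝ) < q := zero_lt_one.trans hq1
  have hR : 0 < 2 * ε * Real.log q / (d + 1 : ℕ) :=
    div_pos (mul_pos (by positivity) (Real.log_pos hq1)) (by positivity)
  have hL : 0 < (∑ x, P x ^ (d + 1)) ^ (d : ℝ)⁻¹ := Real.rpow_pos_of_pos hpos _
  rw [← Real.logb_le_logb hq1 (mul_pos (pow_pos hq0 m) hL) hR,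
    Real.logb_mul (pow_pos hq0 m).ne' hL.ne', Real.logb_pow, Real.logb_self_eq_one hq1, mul_one,
    Real.logb_rpow_eq_mul_logb_of_pos hpos]
  rw [← inv_div, Real.logb_inv, renyiH] at hmH
  simp only [Real.rpow_natCast] at hmH
  have hd : (1 - ((d + 1 : ℕ) : ℝ))⁻¹ = -(d : ℝ)⁻¹ := by
    rw [← inv_neg]
    congr 1
    push_cast
    ring
  rw [hd] at hmH
  linarith

/-- Theorem 4.2: for a `k*`-universal hash function, if
`m ≤ H_k(X) - log_q(k/(2ε ln q))`, then the conditional `∞`-Rényi divergence of the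
hash output from uniform satisfies
`D_∞(P_{h(S,X)} ‖ P_U | P_S) ≤ m/k + ε`. -/
theorem lhl_min_entropy {S X : Type*} [Fintype S] [Fintype X] [Nonempty S] [Nonempty X]
    (q m k : ℕ) [NeZero q] (hq : 2 ≤ q) (hm : 1 ≤ m) (hk : 2 ≤ k)
    (ε : ℝ) (hε : 0 < ε)
    (h : S → X → (Fin m → Fin q)) (P : X → ℝ)
    (hP0 : ∀ x, 0 ≤ P x) (hP1 : ∑ x, P x = 1)
    (hUniv : ∀ l : ℕ, 2 ≤ l → l ≤ k → ∀ x : Fin l → X, Function.Injective x →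
      ((univ.filter fun s : S => ∀ i j, h s (x i) = h s (x j)).card : ℝ)
          / (Fintype.card S : ℝ)
        ≤ ((q : ℝ) ^ (m * (l - 1)))⁻¹)
    (hmH : (m : ℝ) ≤ renyiH q k P - Real.logb q ((k : ℝ) / (2 * ε * Real.log q))) :
    ∑ s : S, (Fintype.card S : ℝ)⁻¹ *
        (⨆ u : Fin m → Fin q,
          Real.logb q ((q : ℝ) ^ m * ∑ x : X, if h s x = u then P x else 0))
      ≤ (m : ℝ) / k + ε := by
  obtain ⟨d, rfl⟩ : ∃ d, k = d + 1 := ⟨k - 1, by omega⟩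
  have hq1 : (1 : ℝ) < q := by exact_mod_cast hq
  have hq0 : (0 : ℝ) < q := zero_lt_one.trans hq1
  have hlog : 0 < Real.log q := Real.log_pos hq1
  have hpos : 0 < ∑ x, P x ^ (d + 1) := by
    obtain ⟨x, -, hx⟩ : ∃ x ∈ (univ : Finset X), 0 < P x :=
      exists_lt_of_sum_lt (by simp [hP1])
    exact sum_pos' (fun x _ => pow_nonneg (hP0 x) _) ⟨x, mem_univ x, pow_pos hx _⟩
  set r : ℝ := (∑ x, P x ^ (d + 1)) ^ (d : ℝ)⁻¹ with hr
  have hr0 : 0 ≤ r := (Real.rpow_pos_of_pos hpos _).le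
  have ht : (q : ℝ) ^ m * r ≤ 2 * ε * Real.log q / (d + 1 : ℕ) :=
    pow_mul_rpow_le_of_le_renyiH hq hε hpos hmH
  have hmean := universal_power_sum_le q m (d + 1) (by omega) (by omega) h hP0 hUniv hr0
    fun c hc => sum_pow_succ_le_rpow_pow hP0 hP1 (Nat.lt_succ_iff.1 hc)
  set c : ℝ := (q : ℝ) ^ m *
    Real.exp (((d + 1 : ℕ) : ℝ) * (((d + 1 : ℕ) : ℝ) - 1) / 2 * ((q : ℝ) ^ m * r)) with hc
  have hc0 : 0 < c := mul_pos (pow_pos hq0 m) (Real.exp_pos _)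
  have hlogc : Real.log c ≤ m * Real.log q + d * (ε * Real.log q) := by
    rw [hc, Real.log_mul (pow_pos hq0 m).ne' (Real.exp_pos _).ne', Real.log_exp, Real.log_pow]
    rw [le_div_iff₀ (by positivity)] at ht
    push_cast at ht ⊢
    nlinarith [mul_le_mul_of_nonneg_left ht (Nat.cast_nonneg (α := ℝ) d)]
  have hcard : (Fintype.card (Fin m → Fin q) : ℝ) = (q : ℝ) ^ m := by simp
  set Y : S → ℝ := fun s =>
    ∑ u : Fin m → Fin q, ((q : ℝ) ^ m * ∑ x : X, if h s x = u then P x else 0) ^ (d + 1) with hY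
  have hS : (Fintype.card S : ℝ) ≠ 0 := by exact_mod_cast Fintype.card_ne_zero
  calc ∑ s : S, (Fintype.card S : ℝ)⁻¹ * (⨆ u : Fin m → Fin q,
          Real.logb q ((q : ℝ) ^ m * ∑ x : X, if h s x = u then P x else 0))
      ≤ ∑ s : S, (Fintype.card S : ℝ)⁻¹ *
          ((Real.log c + Y s / c - 1) / ((d + 1 : ℕ) * Real.log q)) := by
        gcongr with s
        have hfib := iSup_logb_le_tangent (U := Fin m → Fin q)
          (p := fun u => ∑ x : X, if h s x = u then P x else 0)
          (fun u => sum_nonneg fun x _ => by split_ifs; exacts [hP0 x, le_rfl])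
          (by rw [sum_comm]; simpa using hP1) hq1 hc0 (Nat.succ_pos d)
        simpa only [hcard] using hfib
    _ = (Real.log c + (∑ s : S, (Fintype.card S : ℝ)⁻¹ * Y s) / c - 1) /
          ((d + 1 : ℕ) * Real.log q) := by
        simp only [← mul_sum, ← sum_div, sum_sub_distrib, sum_add_distrib, sum_const, card_univ,
          nsmul_eq_mul]
        field_simp
    _ ≤ Real.log c / ((d + 1 : ℕ) * Real.log q) := by
        have : (∑ s : S, (Fintype.card S : ℝ)⁻¹ * Y s) / c ≤ 1 := (div_le_one hc0).2 hmean
        gcongr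
        linarith
    _ ≤ (m : ℝ) / (d + 1 : ℕ) + ε := by
        rw [div_le_iff₀ (by positivity)]
        have : ((m : ℝ) / (d + 1 : ℕ) + ε) * ((d + 1 : ℕ) * Real.log q) =
            m * Real.log q + (d + 1 : ℕ) * (ε * Real.log q) := by
          field_simp
        rw [this]
        push_cast
        nlinarith [mul_pos hε hlog]
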